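/- arXiv:2109.13687 — 2 statements merged into one kernel-verified Lean document; each statement's English description precedes it below -/
import Mathlib

section
/- Let Â = fromBlocks 0 I_m A₂₁ A₂₂ be a real 2m×2m matrix (for some m×m matrices A₂₁, A₂₂), let B₂ be a real m×p matrix with rank B₂ = p ≤ m, and let B̂ be the 2m×p matrix whose first m rows are 0 and whose last m rows are B₂. Then there exists an invertible m×m matrix W₁ such that, with W := blkdiag(W₁, W₁) (the 2m×2m block-diagonal matrix with two copies of W₁), the matrix W·B̂ has its first 2m−p rows equal to 0 and its last p rows equal to I_p, and W·Â·W⁻¹ = fromBlocks 0 I_m Ã₂₁ Ã₂₂ for some m×m matrices Ã₂₁, Ã₂₂. -/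
open Matrix

/-- A linearly independent family of `p` vectors in an `m`-dimensional space is the tail of some
basis indexed by `Fin m`. -/
theorem LinearIndependent.exists_basis_fin_tail {K V : Type*} [DivisionRing K] [AddCommGroup V]
    [Module K V] [FiniteDimensional K V] {m p : ℕ} (hm : Module.finrank K V = m) (hp : p ≤ m)
    {v : Fin p → V} (hv : LinearIndependent K v) :
    ∃ b : Module.Basis (Fin m) K V,
      ∀ (i : Fin m) (j : Fin p), (i : ℕ) = m - p + (j : ℕ) → b i = v j := by
  let b := Module.Basis.sumExtend hv
  have : Finite (Fin p ⊕ Module.Basis.sumExtendIndex hv) := Module.Finite.finite_basis b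
  have : Finite (Module.Basis.sumExtendIndex hv) := Finite.sum_right (Fin p)
  have hcard : Nat.card (Module.Basis.sumExtendIndex hv) = m - p := by
    have h := Module.finrank_eq_nat_card_basis b
    rw [hm, Nat.card_sum, Nat.card_fin] at h
    omega
  let e : Fin p ⊕ Module.Basis.sumExtendIndex hv ≃ Fin m :=
    (Equiv.sumComm _ _).trans <|
      ((Finite.equivFinOfCardEq hcard).sumCongr (Equiv.refl _)).trans <|
        finSumFinEquiv.trans (finCongr (Nat.sub_add_cancel hp))
  refine ⟨b.reindex e, fun i j hij => ?_⟩
  have he : e (Sum.inl j) = i := by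
    ext
    simp [e, hij]
  rw [Module.Basis.reindex_apply, ← he, Equiv.symm_apply_apply]
  simp only [b, Module.Basis.sumExtend, Module.Basis.reindex_apply, Module.Basis.extend_apply_self]
  rfl

/-- A matrix of full column rank is brought by an invertible left factor to the matrix whose last
rows form the identity and whose other rows vanish. -/
theorem Matrix.exists_isUnit_mul_eq_of_rank_eq {K : Type*} [Field K] {m p : ℕ} (hp : p ≤ m)
    (B : Matrix (Fin m) (Fin p) K) (hB : B.rank = p) :
    ∃ W : Matrix (Fin m) (Fin m) K, IsUnit W ∧
      W * B = Matrix.of fun (i : Fin m) (j : Fin p) =>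
        if (i : ℕ) = m - p + (j : ℕ) then (1 : K) else 0 := by
  have hv : LinearIndependent K B.col := by
    rw [linearIndependent_iff_card_eq_finrank_span, Set.finrank, ← Matrix.rank_eq_finrank_span_cols,
      hB, Fintype.card_fin]
  obtain ⟨b, hb⟩ := hv.exists_basis_fin_tail (Module.finrank_fin_fun K) hp
  refine ⟨b.toMatrix (Pi.basisFun K (Fin m)),
    ⟨⟨_, _, b.toMatrix_mul_toMatrix_flip _, (Pi.basisFun K (Fin m)).toMatrix_mul_toMatrix_flip b⟩,
      rfl⟩, ?_⟩
  have hBm : B = (Pi.basisFun K (Fin m)).toMatrix B.col := by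
    ext i j
    simp [Module.Basis.toMatrix_apply]
  rw [hBm, Module.Basis.toMatrix_mul_toMatrix]
  ext i j
  have hk : m - p + (j : ℕ) < m := by omega
  rw [Module.Basis.toMatrix_apply, ← hb ⟨m - p + j, hk⟩ j rfl, Module.Basis.repr_self,
    Finsupp.single_apply]
  simp [Fin.ext_iff, eq_comm]

/-- Subsequent unifying transformation: if `(Â, B̂)` is in mechanical normal
form with `rank B₂ = p ≤ m`, there is an invertible `W₁` such that `W = blkdiag(W₁, W₁)`
maps `B̂` to the matrix with first `2m − p` rows zero and last `p` rows `I_p`, while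
preserving the mechanical normal form of the state matrix. -/
theorem unifying_transformation (m p : ℕ) (hp : p ≤ m)
    (A21 A22 : Matrix (Fin m) (Fin m) ℝ)
    (B2 : Matrix (Fin m) (Fin p) ℝ) (hB2 : B2.rank = p) :
    ∃ W₁ : Matrix (Fin m) (Fin m) ℝ, IsUnit W₁ ∧
      Matrix.fromBlocks W₁ 0 0 W₁ * Matrix.fromRows (0 : Matrix (Fin m) (Fin p) ℝ) B2 =
        Matrix.fromRows 0
          (Matrix.of fun (i : Fin m) (j : Fin p) =>
            if (i : ℕ) = m - p + (j : ℕ) then (1 : ℝ) else 0) ∧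
      ∃ A21' A22' : Matrix (Fin m) (Fin m) ℝ,
        Matrix.fromBlocks W₁ 0 0 W₁ * Matrix.fromBlocks 0 1 A21 A22 *
            (Matrix.fromBlocks W₁ 0 0 W₁)⁻¹ =
          Matrix.fromBlocks 0 1 A21' A22' := by
  obtain ⟨W, hW, hWB⟩ := Matrix.exists_isUnit_mul_eq_of_rank_eq hp B2 hB2
  have hdet : IsUnit W.det := (Matrix.isUnit_iff_isUnit_det W).mp hW
  have hinv : (Matrix.fromBlocks W 0 0 W)⁻¹ = Matrix.fromBlocks W⁻¹ 0 0 W⁻¹ := by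
    apply Matrix.inv_eq_right_inv
    simp [Matrix.fromBlocks_multiply, Matrix.mul_nonsing_inv W hdet]
  refine ⟨W, hW, ?_, W * A21 * W⁻¹, W * A22 * W⁻¹, ?_⟩
  · rw [Matrix.fromBlocks_mul_fromRows, hWB]
    simp
  · rw [hinv]
    simp [Matrix.fromBlocks_multiply, Matrix.mul_nonsing_inv W hdet]
end

section
/- Let p < m. (i) An m×m real matrix Q₁ satisfies Q₁·N = N, where N is the m×p matrix whose first m−p rows are 0 and whose last p rows are I_p, if and only if Q₁ = fromBlocks Q₁₁ 0 Q₁₂ I_p for some (m−p)×(m−p) matrix Q₁₁ and some p×(m−p) matrix Q₁₂; such a Q₁ is invertible if and only if Q₁₁ is invertible. (ii) If Q₁ = fromBlocks Q₁₁ 0 Q₁₂ I_p with Q₁₁ invertible, Q := blkdiag(Q₁, Q₁), Ã = fromBlocks 0 I_m Ã₂₁ Ã₂₂ is any real 2m×2m matrix of mechanical normal form, and B̃ is the 2m×p matrix whose first 2m−p rows are 0 and last p rows are I_p, then Q·B̃ = B̃ and Q·Ã·Q⁻¹ = fromBlocks 0 I_m A'₂₁ A'₂₂ for some m×m matrices A'₂₁,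 A'₂₂. -/
open Matrix

namespace Matrix

variable {n k l R : Type*} [CommRing R]

theorem fromBlocks_mul_fromRows_zero [Fintype n] [Fintype k] (A : Matrix n n R)
    (B : Matrix n k R) (C : Matrix k n R) (D : Matrix k k R) (M : Matrix k l R) :
    fromBlocks A B C D * fromRows (0 : Matrix n l R) M = fromRows (B * M) (D * M) := by
  simp [fromBlocks_mul_fromRows]

theorem mul_fromRows_zero_one_eq_iff [Fintype n] [Fintype k] [DecidableEq k]
    (Q : Matrix (n ⊕ k) (n ⊕ k) R) :
    Q * fromRows (0 : Matrix n k R) (1 : Matrix k k R) = fromRows 0 1 ↔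
      ∃ (A : Matrix n n R) (C : Matrix k n R), Q = fromBlocks A 0 C 1 := by
  constructor
  · intro h
    rw [← fromBlocks_toBlocks Q, fromBlocks_mul_fromRows_zero, fromRows_inj.eq_iff,
      Matrix.mul_one, Matrix.mul_one] at h
    refine ⟨Q.toBlocks₁₁, Q.toBlocks₂₁, ?_⟩
    rw [← h.1, ← h.2, fromBlocks_toBlocks]
  · rintro ⟨A, C, rfl⟩
    rw [fromBlocks_mul_fromRows_zero, Matrix.mul_one, Matrix.mul_one]

theorem blkdiag_mul_fromRows_zero [Fintype n] {Q : Matrix n n R} {M : Matrix n l R}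
    (h : Q * M = M) :
    fromBlocks Q 0 0 Q * fromRows (0 : Matrix n l R) M = fromRows 0 M := by
  rw [fromBlocks_mul_fromRows_zero, Matrix.zero_mul, h]

theorem isUnit_fromBlocks_zero_one_iff [Fintype n] [DecidableEq n] [Fintype k] [DecidableEq k]
    (A : Matrix n n R) (C : Matrix k n R) :
    IsUnit (fromBlocks A 0 C (1 : Matrix k k R)) ↔ IsUnit A := by
  simp [isUnit_fromBlocks_zero₁₂]

theorem blkdiag_conj_companion [Fintype n] [DecidableEq n] {Q : Matrix n n R} (hQ : IsUnit Q)
    (A B : Matrix n n R) :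
    fromBlocks Q 0 0 Q * fromBlocks 0 1 A B * (fromBlocks Q 0 0 Q)⁻¹ =
      fromBlocks 0 1 (Q * A * Q⁻¹) (Q * B * Q⁻¹) := by
  have hdet : IsUnit Q.det := (isUnit_iff_isUnit_det Q).mp hQ
  have hinv : (fromBlocks Q 0 0 Q)⁻¹ = fromBlocks Q⁻¹ 0 0 Q⁻¹ := by
    apply inv_eq_right_inv
    simp [fromBlocks_multiply, mul_nonsing_inv Q hdet]
  simp [hinv, fromBlocks_multiply, mul_nonsing_inv Q hdet]

end Matrix

/-- Non-uniqueness of the unified mechanical normal form.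
(i) `Q₁·N = N` iff `Q₁ = fromBlocks Q₁₁ 0 Q₁₂ I`, and such a `Q₁` is invertible iff `Q₁₁` is.
(ii) For invertible `Q₁₁`, the transformation `Q = blkdiag(Q₁, Q₁)` leaves the unified input
matrix `B̃` invariant and preserves the mechanical normal form of the state matrix. -/
theorem normal_form_nonuniqueness (m p : ℕ) (hp : p < m)
    (Q₁ : Matrix (Fin (m - p) ⊕ Fin p) (Fin (m - p) ⊕ Fin p) ℝ) :
    (Q₁ * Matrix.fromRows (0 : Matrix (Fin (m - p)) (Fin p) ℝ) (1 : Matrix (Fin p) (Fin p) ℝ) =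
        Matrix.fromRows 0 1 ↔
      ∃ (Q11 : Matrix (Fin (m - p)) (Fin (m - p)) ℝ) (Q12 : Matrix (Fin p) (Fin (m - p)) ℝ),
        Q₁ = Matrix.fromBlocks Q11 0 Q12 1) ∧
    (∀ (Q11 : Matrix (Fin (m - p)) (Fin (m - p)) ℝ) (Q12 : Matrix (Fin p) (Fin (m - p)) ℝ),
      Q₁ = Matrix.fromBlocks Q11 0 Q12 1 → (IsUnit Q₁ ↔ IsUnit Q11)) ∧
    (∀ (Q11 : Matrix (Fin (m - p)) (Fin (m - p)) ℝ) (Q12 : Matrix (Fin p) (Fin (m - p)) ℝ),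
      IsUnit Q11 →
      ∀ (A21 A22 : Matrix (Fin (m - p) ⊕ Fin p) (Fin (m - p) ⊕ Fin p) ℝ),
        Matrix.fromBlocks (Matrix.fromBlocks Q11 0 Q12 1) 0 0 (Matrix.fromBlocks Q11 0 Q12 1) *
            Matrix.fromRows (0 : Matrix (Fin (m - p) ⊕ Fin p) (Fin p) ℝ)
              (Matrix.fromRows (0 : Matrix (Fin (m - p)) (Fin p) ℝ) (1 : Matrix (Fin p) (Fin p) ℝ)) =
          Matrix.fromRows 0 (Matrix.fromRows 0 1) ∧
        ∃ A21' A22' : Matrix (Fin (m - p) ⊕ Fin p) (Fin (m - p) ⊕ Fin p) ℝ,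
          Matrix.fromBlocks (Matrix.fromBlocks Q11 0 Q12 1) 0 0 (Matrix.fromBlocks Q11 0 Q12 1) *
              Matrix.fromBlocks 0 1 A21 A22 *
              (Matrix.fromBlocks (Matrix.fromBlocks Q11 0 Q12 1) 0 0
                (Matrix.fromBlocks Q11 0 Q12 1))⁻¹ =
            Matrix.fromBlocks 0 1 A21' A22') := by
  refine ⟨mul_fromRows_zero_one_eq_iff Q₁, ?_, ?_⟩
  · rintro Q11 Q12 rfl
    exact isUnit_fromBlocks_zero_one_iff Q11 Q12
  · intro Q11 Q12 hQ A21 A22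
    refine ⟨blkdiag_mul_fromRows_zero ((mul_fromRows_zero_one_eq_iff _).mpr ⟨Q11, Q12, rfl⟩), _, _,
      blkdiag_conj_companion ((isUnit_fromBlocks_zero_one_iff Q11 Q12).mpr hQ) A21 A22⟩
end
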